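/- If u is a complex n×n matrix that is symmetric (u = uᵀ) and unitary (u · conj(u)ᵀ = I), then there exists a symmetric unitary matrix w with w² = u. -/

import Mathlib

open Matrix

open scoped Matrix.Norms.L2Operator in
/-- A unitary complex matrix has a unitary square root which is a polynomial in it. -/
theorem Matrix.exists_polynomial_unitary_sqrt {ι : Type*} [Fintype ι] [DecidableEq ι]
    {u : Matrix ι ι ℂ} (hu : u ∈ unitary (Matrix ι ι ℂ)) :
    ∃ p : Polynomial ℂ, Polynomial.aeval u p ∈ unitary (Matrix ι ι ℂ) ∧
      Polynomial.aeval u p * Polynomial.aeval u p = u := by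
  have hnormal : IsStarNormal u := ⟨hu.1.trans hu.2.symm⟩
  have hfin : (spectrum ℂ u).Finite := Matrix.finite_spectrum u
  obtain ⟨p, hp⟩ : ∃ p : Polynomial ℂ, ∀ z ∈ spectrum ℂ u, p.eval z = z ^ (1 / 2 : ℂ) :=
    ⟨Lagrange.interpolate hfin.toFinset id (fun z : ℂ => z ^ (1 / 2 : ℂ)), fun z hz =>
      Lagrange.eval_interpolate_at_node (v := id) _ Function.injective_id.injOn
        (hfin.mem_toFinset.mpr hz)⟩
  have hsq : ∀ z ∈ spectrum ℂ u, p.eval z * p.eval z = z := fun z hz => by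
    rw [hp z hz, ← sq, one_div]
    exact_mod_cast Complex.cpow_nat_inv_pow z two_ne_zero
  have hnorm : ∀ z ∈ spectrum ℂ u, star (p.eval z) * p.eval z = 1 := fun z hz => by
    have h1 : ‖z‖ = 1 := by simpa using spectrum.subset_circle_of_unitary hu hz
    have h2 : ‖p.eval z‖ * ‖p.eval z‖ = 1 := by rw [← norm_mul, hsq z hz, h1]
    have h3 : ‖p.eval z‖ = 1 := by nlinarith [norm_nonneg (p.eval z)]
    rw [Complex.star_def, Complex.conj_mul', h3]
    norm_num
  have hcfc : Polynomial.aeval u p = cfc p.eval u := (cfc_polynomial p u).symm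
  refine ⟨p, ?_, ?_⟩
  · rw [hcfc]
    exact (cfc_unitary_iff p.eval u).mpr hnorm
  · rw [hcfc, ← cfc_mul p.eval p.eval u, cfc_congr hsq, cfc_id' ℂ u]

/-- A polynomial in a symmetric matrix is symmetric. -/
theorem Matrix.IsSymm.aeval {ι R : Type*} [Fintype ι] [DecidableEq ι] [CommRing R]
    {A : Matrix ι ι R} (hA : A.IsSymm) (p : Polynomial R) :
    (Polynomial.aeval A p).IsSymm := by
  rw [Matrix.IsSymm, Polynomial.aeval_eq_sum_range, Matrix.transpose_sum]
  simp only [Matrix.transpose_smul, Matrix.transpose_pow, hA.eq]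

/-- If `u` is a complex `n × n` matrix that is symmetric (`u = uᵀ`) and unitary
(`u ⬝ conj(u)ᵀ = 1`), then there exists a symmetric unitary matrix `w` with `w ^ 2 = u`. -/
theorem symmetric_unitary_has_symmetric_unitary_sqrt
    (n : ℕ) (u : Matrix (Fin n) (Fin n) ℂ)
    (hsymm : u = uᵀ)
    (hunit : u * (u.map (starRingEnd ℂ))ᵀ = 1) :
    ∃ w : Matrix (Fin n) (Fin n) ℂ,
      w = wᵀ ∧ w * (w.map (starRingEnd ℂ))ᵀ = 1 ∧ w * w = u := by
  obtain ⟨p, hunitary, hsq⟩ :=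
    Matrix.exists_polynomial_unitary_sqrt (Matrix.mem_unitaryGroup_iff.mpr hunit)
  exact ⟨Polynomial.aeval u p, (Matrix.IsSymm.aeval hsymm.symm p).symm,
    Matrix.mem_unitaryGroup_iff.mp hunitary, hsq⟩
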